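/- Let a : ℝ^n → ℝ be smooth with all derivatives bounded and let u be a Schwartz function on ℝ^n. Then −4 Re ∫_{ℝ^n} ∂_j a ∂_j ū Δ²u dx = −4 Re ∫_{ℝ^n} ( ∂_{ijk}a ∂_j ū ∂_{ik}u + 2 ∂_{jk}a ∂_{ij}ū ∂_{ik}u − (1/2) Δa Σ_{j,k}|∂_{jk}u|² ) dx, where repeated indices i,j,k are summed from 1 to n. -/

import Mathlib

open MeasureTheory Real FourierTransform Filter Topology
open scoped ENNReal NNReal

noncomputable section

abbrev Rn (n : ℕ) := EuclideanSpace ℝ (Fin n)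

variable {n : ℕ}

/-- Fourier multiplier operator with symbol `m`. -/
def fmul (m : Rn n → ℂ) (f : Rn n → ℂ) : Rn n → ℂ :=
  𝓕⁻ fun ξ => m ξ * 𝓕 f ξ

/-- The operator `|∇|^σ`. -/
def absGrad (σ : ℝ) (f : Rn n → ℂ) : Rn n → ℂ :=
  fmul (fun ξ => ((‖ξ‖ ^ σ : ℝ) : ℂ)) f

/-- Squared inhomogeneous Sobolev `H^s` norm. -/
def HsNormSq (s : ℝ) (f : Rn n → ℂ) : ℝ≥0∞ :=
  ∫⁻ ξ, ENNReal.ofReal ((1 + ‖ξ‖ ^ 2) ^ s) * (‖𝓕 f ξ‖₊ : ℝ≥0∞) ^ 2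

def HsN (s : ℝ) (f : Rn n → ℂ) : ℝ≥0∞ := (HsNormSq s f) ^ ((1:ℝ)/2)

/-- Squared homogeneous Sobolev `Ḣ^σ` norm. -/
def HdotNormSq (σ : ℝ) (f : Rn n → ℂ) : ℝ≥0∞ :=
  ∫⁻ ξ, ENNReal.ofReal (‖ξ‖ ^ (2 * σ)) * (‖𝓕 f ξ‖₊ : ℝ≥0∞) ^ 2

/-- `L^p` norm. -/
def LpN (p : ℝ) (f : Rn n → ℂ) : ℝ≥0∞ :=
  (∫⁻ x, (‖f x‖₊ : ℝ≥0∞) ^ p) ^ (1 / p)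

/-- Space-time norm `L^q_t L^r_x` on a time set `I`. -/
def SpaceTimeN (q r : ℝ) (I : Set ℝ) (u : ℝ → Rn n → ℂ) : ℝ≥0∞ :=
  (∫⁻ t in I, (LpN r (u t)) ^ q) ^ (1 / q)

/-- partial derivative in the `i`-th coordinate direction -/
def pd (i : Fin n) (f : Rn n → ℂ) (x : Rn n) : ℂ :=
  fderiv ℝ f x (EuclideanSpace.single i 1)

def pdR (i : Fin n) (f : Rn n → ℝ) (x : Rn n) : ℝ :=
  fderiv ℝ f x (EuclideanSpace.single i 1)

def lap (f : Rn n → ℂ) (x : Rn n) : ℂ := ∑ i, pd i (pd i f) x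
def lapR (f : Rn n → ℝ) (x : Rn n) : ℝ := ∑ i, pdR i (pdR i f) x
def bilap (f : Rn n → ℂ) (x : Rn n) : ℂ := lap (fun y => lap f y) x

/-- cubic nonlinearity `|u|²u` -/
def cubic (f : Rn n → ℂ) (x : Rn n) : ℂ := (‖f x‖ : ℂ) ^ 2 * f x

/-- solves the defocusing cubic fourth-order NLS on the time set `I` -/
def Solves4NLS (I : Set ℝ) (u : ℝ → Rn n → ℂ) : Prop :=
  ∀ t ∈ I, ∀ x, Complex.I * deriv (fun τ => u τ x) t + bilap (u t) x + cubic (u t) x = 0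

/-- Schrödinger admissible pair -/
def SAdm (n : ℕ) (q r : ℝ) : Prop := 2 ≤ q ∧ 2 ≤ r ∧ 2 / q = n * (1/2 - 1/r)
/-- biharmonic admissible pair -/
def BAdm (n : ℕ) (q r : ℝ) : Prop := 2 ≤ q ∧ 2 ≤ r ∧ 4 / q = n * (1/2 - 1/r)

open scoped SchwartzMap LineDeriv

theorem fderiv_fderiv_apply_comm {E F : Type*} [NormedAddCommGroup E] [NormedSpace ℝ E]
    [NormedAddCommGroup F] [NormedSpace ℝ F] {f : E → F} (hf : ContDiff ℝ 2 f) (v w x : E) :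
    fderiv ℝ (fun y => fderiv ℝ f y v) x w = fderiv ℝ (fun y => fderiv ℝ f y w) x v := by
  have hd : DifferentiableAt ℝ (fderiv ℝ f) x :=
    (hf.fderiv_right (m := 1) (by norm_num)).differentiable one_ne_zero x
  have hsymm : IsSymmSndFDerivAt ℝ f x := hf.contDiffAt.isSymmSndFDerivAt (by simp)
  rw [fderiv_clm_apply hd (differentiableAt_const v), fderiv_clm_apply hd (differentiableAt_const w)]
  simpa using hsymm.eq w v

theorem Function.HasTemperateGrowth.fderiv {E F : Type*} [NormedAddCommGroup E] [NormedSpace ℝ E]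
    [NormedAddCommGroup F] [NormedSpace ℝ F] {f : E → F} (hf : f.HasTemperateGrowth) :
    (_root_.fderiv ℝ f).HasTemperateGrowth := by
  refine ⟨hf.1.fderiv_right (by simp), fun k => ?_⟩
  obtain ⟨m, C, h⟩ := hf.2 (k + 1)
  refine ⟨m, C, fun x => ?_⟩
  rw [norm_iteratedFDeriv_fderiv]
  exact h x

theorem hasTemperateGrowth_pdR {f : Rn n → ℝ} (hf : f.HasTemperateGrowth) (i : Fin n) :
    (pdR i f).HasTemperateGrowth :=
  (ContinuousLinearMap.apply ℝ ℝ (EuclideanSpace.single i (1 : ℝ))).hasTemperateGrowth.comp hf.fderiv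

theorem pdR_comm {f : Rn n → ℝ} (hf : f.HasTemperateGrowth) (i j : Fin n) :
    pdR i (pdR j f) = pdR j (pdR i f) :=
  funext fun x => fderiv_fderiv_apply_comm (hf.1.of_le (by norm_cast)) _ _ x

/-- The partial derivative in the `i`-th coordinate direction on Schwartz functions. -/
def schwartzPd (i : Fin n) : 𝓢(Rn n, ℂ) →L[ℝ] 𝓢(Rn n, ℂ) :=
  LineDeriv.lineDerivOpCLM ℝ 𝓢(Rn n, ℂ) (EuclideanSpace.single i (1 : ℝ))

theorem coe_schwartzPd (i : Fin n) (f : 𝓢(Rn n, ℂ)) : ⇑(schwartzPd i f) = pd i f :=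
  funext fun x => SchwartzMap.lineDerivOp_apply_eq_fderiv _ f x

theorem schwartzPd_comm (i j : Fin n) (f : 𝓢(Rn n, ℂ)) :
    schwartzPd i (schwartzPd j f) = schwartzPd j (schwartzPd i f) := by
  ext x
  simp only [coe_schwartzPd]
  exact fderiv_fderiv_apply_comm (f.smooth 2) _ _ x

/-- Pointwise complex conjugation on Schwartz functions. -/
def schwartzConj (f : 𝓢(Rn n, ℂ)) : 𝓢(Rn n, ℂ) :=
  f.postcompCLM (Complex.conjCLE : ℂ →L[ℝ] ℂ)

theorem schwartzConj_apply (f : 𝓢(Rn n, ℂ)) (x : Rn n) :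
    schwartzConj f x = (starRingEnd ℂ) (f x) := rfl

theorem schwartzPd_schwartzConj (i : Fin n) (f : 𝓢(Rn n, ℂ)) :
    schwartzPd i (schwartzConj f) = schwartzConj (schwartzPd i f) := by
  ext x
  rw [schwartzConj_apply, coe_schwartzPd, coe_schwartzPd]
  have h := ((Complex.conjCLE : ℂ →L[ℝ] ℂ).hasFDerivAt.comp x f.differentiableAt.hasFDerivAt).fderiv
  exact congrArg (fun L : Rn n →L[ℝ] ℂ => L (EuclideanSpace.single i 1)) h

theorem bilap_schwartz (f : 𝓢(Rn n, ℂ)) (x : Rn n) :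
    bilap f x = ∑ i, ∑ k, schwartzPd i (schwartzPd i (schwartzPd k (schwartzPd k f))) x := by
  have h : (fun y => lap f y) = ⇑(∑ k, schwartzPd k (schwartzPd k f)) := by
    ext y
    simp [lap, coe_schwartzPd]
  rw [bilap, h, lap]
  refine Finset.sum_congr rfl fun i _ => ?_
  rw [← coe_schwartzPd, ← coe_schwartzPd, map_sum, map_sum, sum_apply]

/-- The integral of `c f g` for a real weight `c` and Schwartz functions `f`, `g`. -/
def weightedIntegral (c : Rn n → ℝ) (f g : 𝓢(Rn n, ℂ)) : ℂ :=
  ∫ x, (c x : ℂ) * f x * g x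

theorem integrable_weighted {c : Rn n → ℝ} (hc : c.HasTemperateGrowth) (f g : 𝓢(Rn n, ℂ)) :
    Integrable fun x => (c x : ℂ) * f x * g x := by
  have hc' : (fun x => (c x : ℂ)).HasTemperateGrowth := Function.Complex.hasTemperateGrowth_ofReal.comp hc
  have h := (SchwartzMap.smulLeftCLM ℂ (fun x => (c x : ℂ) * f x) g).integrable (μ := volume)
  have hcf : (fun x => (c x : ℂ) * f x).HasTemperateGrowth := hc'.mul f.hasTemperateGrowth
  rwa [SchwartzMap.smulLeftCLM_apply hcf] at h

theorem weightedIntegral_schwartzPd {c : Rn n → ℝ} (hc : c.HasTemperateGrowth) (i : Fin n)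
    (f g : 𝓢(Rn n, ℂ)) :
    weightedIntegral c f (schwartzPd i g) =
      -weightedIntegral (pdR i c) f g - weightedIntegral c (schwartzPd i f) g := by
  have hc' : (fun x => (c x : ℂ)).HasTemperateGrowth := Function.Complex.hasTemperateGrowth_ofReal.comp hc
  have key := SchwartzMap.integral_mul_lineDerivOp_right_eq_neg_left (μ := volume)
    (SchwartzMap.smulLeftCLM ℂ (fun x => (c x : ℂ)) f) g (EuclideanSpace.single i (1 : ℝ))
  have hder (x : Rn n) :
      (∂_{EuclideanSpace.single i (1 : ℝ)} (SchwartzMap.smulLeftCLM ℂ (fun x => (c x : ℂ)) f)) x =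
        (pdR i c x : ℂ) * f x + (c x : ℂ) * schwartzPd i f x := by
    have hdc : HasFDerivAt (fun x => (c x : ℂ)) (Complex.ofRealCLM.comp (fderiv ℝ c x)) x :=
      Complex.ofRealCLM.hasFDerivAt.comp x (hc.1.differentiable (by simp) x).hasFDerivAt
    rw [SchwartzMap.lineDerivOp_apply_eq_fderiv, SchwartzMap.smulLeftCLM_apply hc', coe_schwartzPd]
    simp only [smul_eq_mul]
    rw [(hdc.fun_mul f.differentiableAt.hasFDerivAt).fderiv]
    simp [pd, pdR]
    ring
  simp only [hder, SchwartzMap.smulLeftCLM_apply_apply hc', smul_eq_mul] at key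
  have hsplit : (∫ x, ((pdR i c x : ℂ) * f x + (c x : ℂ) * schwartzPd i f x) * g x) =
      weightedIntegral (pdR i c) f g + weightedIntegral c (schwartzPd i f) g := by
    simp only [add_mul]
    exact integral_add (integrable_weighted (hasTemperateGrowth_pdR hc i) f g)
      (integrable_weighted hc _ g)
  rw [hsplit] at key
  rw [← neg_add']
  exact key

theorem weightedIntegral_schwartzConj (c : Rn n → ℝ) (f g : 𝓢(Rn n, ℂ)) :
    weightedIntegral c (schwartzConj f) g =
      (starRingEnd ℂ) (weightedIntegral c (schwartzConj g) f) := by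
  rw [weightedIntegral, weightedIntegral, ← integral_conj]
  refine integral_congr_ae (.of_forall fun x => ?_)
  simp [schwartzConj_apply]
  ring

theorem re_weightedIntegral_schwartzPd_conj {c : Rn n → ℝ} (hc : c.HasTemperateGrowth) (j : Fin n)
    (f : 𝓢(Rn n, ℂ)) :
    (weightedIntegral c (schwartzPd j (schwartzConj f)) f).re =
      -(1 / 2) * (weightedIntegral (pdR j c) (schwartzConj f) f).re := by
  have h := congrArg Complex.re (weightedIntegral_schwartzPd hc j (schwartzConj f) f)
  rw [weightedIntegral_schwartzConj, ← schwartzPd_schwartzConj] at h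
  simp only [Complex.conj_re, Complex.sub_re, Complex.neg_re] at h
  linarith

theorem weightedIntegral_biharmonic {c : Rn n → ℝ} (hc : c.HasTemperateGrowth) (i k : Fin n)
    (f g : 𝓢(Rn n, ℂ)) :
    weightedIntegral c f (schwartzPd i (schwartzPd i (schwartzPd k (schwartzPd k g)))) =
      weightedIntegral (pdR k (pdR i c)) f (schwartzPd i (schwartzPd k g))
        + weightedIntegral (pdR i c) (schwartzPd k f) (schwartzPd i (schwartzPd k g))
        + weightedIntegral (pdR k c) (schwartzPd i f) (schwartzPd i (schwartzPd k g))
        + weightedIntegral c (schwartzPd k (schwartzPd i f)) (schwartzPd i (schwartzPd k g)) := by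
  rw [weightedIntegral_schwartzPd hc, schwartzPd_comm i k (schwartzPd k g),
    weightedIntegral_schwartzPd (hasTemperateGrowth_pdR hc i), weightedIntegral_schwartzPd hc]
  ring

theorem integral_sum_sum_sum {α ι E : Type*} [MeasurableSpace α] {μ : Measure α} [Fintype ι]
    [NormedAddCommGroup E] [NormedSpace ℝ E] {F : ι → ι → ι → α → E}
    (hF : ∀ i j k, Integrable (F i j k) μ) :
    Integrable (fun x => ∑ i, ∑ j, ∑ k, F i j k x) μ ∧
      ∫ x, ∑ i, ∑ j, ∑ k, F i j k x ∂μ = ∑ i, ∑ j, ∑ k, ∫ x, F i j k x ∂μ := by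
  have h1 (i j : ι) : Integrable (fun x => ∑ k, F i j k x) μ :=
    integrable_finsetSum _ fun k _ => hF i j k
  have h2 (i : ι) : Integrable (fun x => ∑ j, ∑ k, F i j k x) μ :=
    integrable_finsetSum _ fun j _ => h1 i j
  refine ⟨integrable_finsetSum _ fun i _ => h2 i, ?_⟩
  rw [integral_finsetSum _ fun i _ => h2 i]
  refine Finset.sum_congr rfl fun i _ => ?_
  rw [integral_finsetSum _ fun j _ => h1 i j]
  exact Finset.sum_congr rfl fun j _ => integral_finsetSum _ fun k _ => hF i j k

/-- second integration-by-parts identity for the Morawetz computation. -/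
theorem stmt_6 (n : ℕ) (a : Rn n → ℝ)
    (ha : ContDiff ℝ (⊤ : ℕ∞) a)
    (hbd : ∀ k : ℕ, ∃ C : ℝ, ∀ x : Rn n, ‖iteratedFDeriv ℝ k a x‖ ≤ C)
    (u : SchwartzMap (Rn n) ℂ) :
    (-4 : ℝ) * (∫ x : Rn n,
        ∑ j, (pdR j a x : ℂ) * (starRingEnd ℂ) (pd j (fun y => u y) x) *
          bilap (fun y => u y) x).re =
      (-4 : ℝ) * (∫ x : Rn n,
        (∑ i, ∑ j, ∑ k, (pdR i (pdR j (pdR k a)) x : ℂ) *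
            (starRingEnd ℂ) (pd j (fun y => u y) x) * pd i (pd k (fun y => u y)) x
          + 2 * ∑ i, ∑ j, ∑ k, (pdR j (pdR k a) x : ℂ) *
              (starRingEnd ℂ) (pd i (pd j (fun y => u y)) x) * pd i (pd k (fun y => u y)) x
          - (1/2 : ℂ) * (lapR a x : ℂ) *
              ∑ j, ∑ k, (‖pd k (pd j (fun y => u y)) x‖ : ℂ) ^ 2)).re := by
  have hat : a.HasTemperateGrowth := ⟨ha, fun k => by
    obtain ⟨C, hC⟩ := hbd k
    exact ⟨0, C, fun x => by simpa using hC x⟩⟩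
  have h1 (j : Fin n) := hasTemperateGrowth_pdR hat j
  have h2 (i j : Fin n) := hasTemperateGrowth_pdR (h1 j) i
  have h3 (i j k : Fin n) := hasTemperateGrowth_pdR (h2 j k) i
  set w := schwartzConj u with hw
  have hw1 (j : Fin n) (x : Rn n) : schwartzPd j w x = (starRingEnd ℂ) (pd j u x) := by
    rw [hw, schwartzPd_schwartzConj, schwartzConj_apply, coe_schwartzPd]
  have hw2 (i j : Fin n) (x : Rn n) :
      schwartzPd i (schwartzPd j w) x = (starRingEnd ℂ) (pd i (pd j u) x) := by
    rw [hw, schwartzPd_schwartzConj, schwartzPd_schwartzConj, schwartzConj_apply, coe_schwartzPd,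
      coe_schwartzPd]
  have hu2 (i j : Fin n) (x : Rn n) : schwartzPd i (schwartzPd j u) x = pd i (pd j u) x := by
    rw [coe_schwartzPd, coe_schwartzPd]
  obtain ⟨-, hL⟩ := integral_sum_sum_sum fun j i k => integrable_weighted (h1 j) (schwartzPd j w)
    (schwartzPd i (schwartzPd i (schwartzPd k (schwartzPd k u))))
  obtain ⟨iR1, hR1⟩ := integral_sum_sum_sum fun i j k => integrable_weighted (h3 i j k)
    (schwartzPd j w) (schwartzPd i (schwartzPd k u))
  obtain ⟨iR2, hR2⟩ := integral_sum_sum_sum fun i j k => integrable_weighted (h2 j k)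
    (schwartzPd i (schwartzPd j w)) (schwartzPd i (schwartzPd k u))
  obtain ⟨iR3, hR3⟩ := integral_sum_sum_sum fun j i k => integrable_weighted (h2 j j)
    (schwartzPd k (schwartzPd i w)) (schwartzPd i (schwartzPd k u))
  simp only [← weightedIntegral.eq_1] at hL hR1 hR2 hR3
  have hleft : (∫ x : Rn n, ∑ j, (pdR j a x : ℂ) * (starRingEnd ℂ) (pd j (fun y => u y) x) *
      bilap (fun y => u y) x) = ∑ j, ∑ i, ∑ k, weightedIntegral (pdR j a) (schwartzPd j w)
        (schwartzPd i (schwartzPd i (schwartzPd k (schwartzPd k u)))) := by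
    rw [← hL]
    simp only [bilap_schwartz, hw1, Finset.mul_sum]
  have hright : (∫ x : Rn n,
        (∑ i, ∑ j, ∑ k, (pdR i (pdR j (pdR k a)) x : ℂ) *
            (starRingEnd ℂ) (pd j (fun y => u y) x) * pd i (pd k (fun y => u y)) x
          + 2 * ∑ i, ∑ j, ∑ k, (pdR j (pdR k a) x : ℂ) *
              (starRingEnd ℂ) (pd i (pd j (fun y => u y)) x) * pd i (pd k (fun y => u y)) x
          - (1/2 : ℂ) * (lapR a x : ℂ) *
              ∑ j, ∑ k, (‖pd k (pd j (fun y => u y)) x‖ : ℂ) ^ 2)) =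
      ∑ i, ∑ j, ∑ k, weightedIntegral (pdR i (pdR j (pdR k a))) (schwartzPd j w)
          (schwartzPd i (schwartzPd k u))
        + 2 * ∑ i, ∑ j, ∑ k, weightedIntegral (pdR j (pdR k a)) (schwartzPd i (schwartzPd j w))
          (schwartzPd i (schwartzPd k u))
        - (1 / 2) * ∑ j, ∑ i, ∑ k, weightedIntegral (pdR j (pdR j a))
          (schwartzPd k (schwartzPd i w)) (schwartzPd i (schwartzPd k u)) := by
    rw [← hR1, ← hR2, ← hR3, ← integral_const_mul, ← integral_const_mul,
      ← integral_add iR1 (iR2.const_mul 2), ← integral_sub (by exact iR1.add (iR2.const_mul 2))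
        (iR3.const_mul _)]
    refine integral_congr_ae (.of_forall fun x => ?_)
    have hnorm (i k : Fin n) : (‖pd k (pd i u) x‖ : ℂ) ^ 2 =
        (starRingEnd ℂ) (pd k (pd i u) x) * pd i (pd k u) x := by
      rw [← hu2 i k, schwartzPd_comm i k, hu2, Complex.conj_mul']
    have hlap : (lapR a x : ℂ) * ∑ i, ∑ k, (‖pd k (pd i u) x‖ : ℂ) ^ 2 =
        ∑ j, ∑ i, ∑ k, (pdR j (pdR j a) x : ℂ) * (starRingEnd ℂ) (pd k (pd i u) x) *
          pd i (pd k u) x := by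
      rw [lapR, Complex.ofReal_sum, Finset.sum_mul]
      simp only [Finset.mul_sum, hnorm, mul_assoc]
    simp only [hw1, hw2, hu2, ← hlap, ← mul_assoc]
  rw [hleft, hright]
  have hlast (j i k : Fin n) :
      (weightedIntegral (pdR j a) (schwartzPd k (schwartzPd i (schwartzPd j w)))
        (schwartzPd i (schwartzPd k u))).re =
      -(1 / 2) * (weightedIntegral (pdR j (pdR j a)) (schwartzPd k (schwartzPd i w))
        (schwartzPd i (schwartzPd k u))).re := by
    have h := re_weightedIntegral_schwartzPd_conj (h1 j) j (schwartzPd i (schwartzPd k u))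
    rwa [← schwartzPd_schwartzConj, ← schwartzPd_schwartzConj, ← hw, schwartzPd_comm i k w,
      schwartzPd_comm j k, schwartzPd_comm j i] at h
  have hthird : ∑ j, ∑ i, ∑ k, (weightedIntegral (pdR k (pdR i (pdR j a))) (schwartzPd j w)
        (schwartzPd i (schwartzPd k u))).re =
      ∑ i, ∑ j, ∑ k, (weightedIntegral (pdR i (pdR j (pdR k a))) (schwartzPd j w)
        (schwartzPd i (schwartzPd k u))).re := by
    rw [Finset.sum_comm]
    refine Finset.sum_congr rfl fun i _ => Finset.sum_congr rfl fun j _ =>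
      Finset.sum_congr rfl fun k _ => ?_
    rw [pdR_comm (h1 j) k i, pdR_comm hat k j]
  have hmixed : ∑ j, ∑ i, ∑ k, (weightedIntegral (pdR k (pdR j a)) (schwartzPd i (schwartzPd j w))
        (schwartzPd i (schwartzPd k u))).re =
      ∑ i, ∑ j, ∑ k, (weightedIntegral (pdR j (pdR k a)) (schwartzPd i (schwartzPd j w))
        (schwartzPd i (schwartzPd k u))).re := by
    rw [Finset.sum_comm]
    refine Finset.sum_congr rfl fun i _ => Finset.sum_congr rfl fun j _ =>
      Finset.sum_congr rfl fun k _ => ?_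
    rw [pdR_comm hat k j]
  have hmixed' : ∑ j, ∑ i, ∑ k, (weightedIntegral (pdR i (pdR j a)) (schwartzPd k (schwartzPd j w))
        (schwartzPd i (schwartzPd k u))).re =
      ∑ j, ∑ i, ∑ k, (weightedIntegral (pdR k (pdR j a)) (schwartzPd i (schwartzPd j w))
        (schwartzPd i (schwartzPd k u))).re := by
    refine Finset.sum_congr rfl fun j _ => ?_
    rw [Finset.sum_comm]
    refine Finset.sum_congr rfl fun i _ => Finset.sum_congr rfl fun k _ => ?_
    rw [schwartzPd_comm i k u]
  have hre2 (z : ℂ) : ((2 : ℂ) * z).re = 2 * z.re := by simp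
  have hreh (z : ℂ) : ((1 / 2 : ℂ) * z).re = 1 / 2 * z.re := by simp
  simp only [weightedIntegral_biharmonic (h1 _), Complex.sub_re, Complex.add_re, Complex.re_sum,
    hre2, hreh, hlast, Finset.sum_add_distrib, hmixed', hmixed, hthird, ← Finset.mul_sum]
  ring
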